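/- Let n ≥ 8 and let 𝒻 be a family of 3-element subsets of [n] that shatters no 3-element subset, with |𝒻| ≥ C(n−1, 2) + 2. Assume that every family of 3-element subsets of an (n−1)-element set that shatters no 3-element subset has size at most C(n−2, 2) + 1. Let W be a maximal witness assignment for 𝒻, and set ℬ := {W(F) : F ∈ 𝒻, |W(F)| = 2}, L := {x ∈ [n] : there exists F ∈ 𝒻 with W(F) = {x}}, and 𝒞 := {F ∈ 𝒻 : W(F) = ∅}. Then |𝒻| = |ℬ| + |L| + |𝒞|. -/

import Mathlib

/-- A family `𝒻` shatters a set `S` if every subset of `S` is the trace of some member of `𝒻`. -/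
def Shatters (𝒻 : Finset (Finset ℕ)) (S : Finset ℕ) : Prop :=
  ∀ T ⊆ S, ∃ F ∈ 𝒻, F ∩ S = T

/-- `W` is a maximal witness assignment for `𝒻`. -/
def MaximalWitness (𝒻 : Finset (Finset ℕ)) (W : Finset ℕ → Finset ℕ) : Prop :=
  ∀ F ∈ 𝒻, W F ⊂ F ∧ (∀ G ∈ 𝒻, G ∩ F ≠ W F) ∧
    ∀ B : Finset ℕ, B ⊂ F → (W F).card < B.card → ∃ G ∈ 𝒻, G ∩ F = B

open Finset hiding Shatters

/-- In a `3`-uniform family, a member `F` is the only member containing a `2`-subset of `F` that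
is not a trace on `F`. -/
theorem eq_of_pair_not_trace {𝒻 : Finset (Finset ℕ)} (hcard : ∀ F ∈ 𝒻, F.card = 3)
    {F G B : Finset ℕ} (hF : F ∈ 𝒻) (hG : G ∈ 𝒻) (hB : B.card = 2) (hBF : B ⊆ F)
    (hBG : B ⊆ G) (h : ∀ G ∈ 𝒻, G ∩ F ≠ B) : G = F := by
  have hsub : B ⊆ G ∩ F := subset_inter hBG hBF
  have hlt : B.card < (G ∩ F).card :=
    card_lt_card (hsub.ssubset_of_ne (h G hG).symm)
  have hGF : G ∩ F = F := eq_of_subset_of_card_le inter_subset_right (by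
    rw [hcard F hF]; omega)
  exact (eq_of_subset_of_card_le (inter_eq_right.mp hGF) (by
    rw [hcard F hF, hcard G hG])).symm

theorem exists_eq_triple {F : Finset ℕ} (hF : F.card = 3) {x a : ℕ} (hx : x ∈ F) (ha : a ∈ F)
    (hax : a ≠ x) : ∃ b, b ≠ x ∧ b ≠ a ∧ F = {x, a, b} := by
  have h : ((F.erase x).erase a).card = 1 := by
    rw [card_erase_of_mem (mem_erase.2 ⟨hax, ha⟩), card_erase_of_mem hx, hF]
  obtain ⟨b, hb⟩ := card_eq_one.1 h
  have hb' : b ∈ (F.erase x).erase a := by simp [hb]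
  simp only [mem_erase] at hb'
  refine ⟨b, hb'.2.1, hb'.1, ?_⟩
  rw [← hb, insert_erase (mem_erase.2 ⟨hax, ha⟩), insert_erase hx]

/-- If all triples `{x, a, y}` belong to a `3`-uniform family without shattered `3`-sets, then
every member avoiding `x` and `a` has a `2`-subset that is not a trace on it. -/
theorem exists_pair_not_trace {V : Finset ℕ} {𝒻 : Finset (Finset ℕ)} (hV : 6 ≤ V.card)
    (hsub : ∀ F ∈ 𝒻, F ⊆ V) (hcard : ∀ F ∈ 𝒻, F.card = 3)
    (hVC : ∀ S ⊆ V, S.card = 3 → ¬ Shatters 𝒻 S) {x a : ℕ}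
    (hstar : ∀ y ∈ (V.erase x).erase a, ({x, a, y} : Finset ℕ) ∈ 𝒻) {F : Finset ℕ}
    (hF : F ∈ 𝒻) (hx : x ∉ F) (ha : a ∉ F) :
    ∃ B ⊆ F, B.card = 2 ∧ ∀ G ∈ 𝒻, G ∩ F ≠ B := by
  have hns := hVC F (hsub F hF) (hcard F hF)
  simp only [Shatters, not_forall, not_exists, not_and] at hns
  obtain ⟨B, hBF, hB⟩ := hns
  refine ⟨B, hBF, ?_, hB⟩
  have hle : B.card ≤ 3 := hcard F hF ▸ card_le_card hBF
  have h3 : B.card ≠ 3 := fun h => hB F hF (by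
    rw [inter_self]
    exact (eq_of_subset_of_card_le hBF (by rw [hcard F hF, h])).symm)
  have h1 : B.card ≠ 1 := fun h => by
    obtain ⟨y, rfl⟩ := card_eq_one.1 h
    have hy : y ∈ F := hBF (mem_singleton_self y)
    refine hB {x, a, y} (hstar y ?_) (by grind)
    simp only [mem_erase]
    exact ⟨by grind, by grind, hsub F hF hy⟩
  have h0 : B.card ≠ 0 := fun h => by
    obtain rfl := card_eq_zero.1 h
    obtain ⟨y, hyV, hy⟩ : ∃ y ∈ V, y ∉ insert x (insert a F) := by
      apply exists_mem_notMem_of_card_lt_card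
      have := card_insert_le x (insert a F)
      have := card_insert_le a F
      have := hcard F hF
      omega
    simp only [mem_insert, not_or] at hy
    refine hB {x, a, y} (hstar y (by simp [hy, hyV])) (by grind)
  omega

/-- If all triples `{x, a, y}` belong to a `3`-uniform family without shattered `3`-sets, then
the members avoiding `x` inject into the pairs avoiding `x` and `a`. -/
theorem card_filter_notMem_le {V : Finset ℕ} {𝒻 : Finset (Finset ℕ)} (hV : 6 ≤ V.card)
    (hsub : ∀ F ∈ 𝒻, F ⊆ V) (hcard : ∀ F ∈ 𝒻, F.card = 3)
    (hVC : ∀ S ⊆ V, S.card = 3 → ¬ Shatters 𝒻 S) {x a : ℕ} (hx : x ∈ V) (ha : a ∈ V)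
    (hax : a ≠ x) (hstar : ∀ y ∈ (V.erase x).erase a, ({x, a, y} : Finset ℕ) ∈ 𝒻) :
    (𝒻.filter (fun F => x ∉ F)).card ≤ (V.card - 2).choose 2 := by
  have hpair : ∀ F : Finset ℕ, ∃ B : Finset ℕ, F ∈ 𝒻 → x ∉ F → B ⊆ F ∧ a ∉ B ∧ B.card = 2 ∧
      ((a ∈ F ∧ F = insert a B) ∨ (a ∉ F ∧ ∀ G ∈ 𝒻, G ∩ F ≠ B)) := by
    intro F
    by_cases hF : F ∈ 𝒻 ∧ x ∉ F
    · by_cases haF : a ∈ F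
      · refine ⟨F.erase a, fun _ _ => ⟨erase_subset _ _, notMem_erase _ _, ?_,
          Or.inl ⟨haF, (insert_erase haF).symm⟩⟩⟩
        rw [card_erase_of_mem haF, hcard F hF.1]
      · obtain ⟨B, hBF, hB, h⟩ := exists_pair_not_trace hV hsub hcard hVC hstar hF.1 hF.2 haF
        exact ⟨B, fun _ _ => ⟨hBF, fun h => haF (hBF h), hB, Or.inr ⟨haF, h⟩⟩⟩
    · exact ⟨∅, fun h h' => absurd ⟨h, h'⟩ hF⟩
  choose P hP using hpair
  have hVcard : ((V.erase x).erase a).card = V.card - 2 := by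
    rw [card_erase_of_mem (mem_erase.2 ⟨hax, ha⟩), card_erase_of_mem hx]
    rfl
  rw [← hVcard, ← card_powersetCard]
  refine card_le_card_of_injOn P ?_ ?_
  · intro F hF
    obtain ⟨hF, hxF⟩ := mem_filter.1 hF
    obtain ⟨hPF, haP, hP2, -⟩ := hP F hF hxF
    refine mem_powersetCard.2 ⟨fun y hy => ?_, hP2⟩
    simp only [mem_erase]
    exact ⟨fun h => haP (h ▸ hy), fun h => hxF (h ▸ hPF hy), hsub F hF (hPF hy)⟩
  · intro F hF G hG hFG
    obtain ⟨hF, hxF⟩ := mem_filter.1 hF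
    obtain ⟨hG, hxG⟩ := mem_filter.1 hG
    obtain ⟨hPF, -, hF2, hF'⟩ := hP F hF hxF
    obtain ⟨hPG, -, hG2, hG'⟩ := hP G hG hxG
    rcases hF' with ⟨-, hF'⟩ | ⟨-, hF'⟩
    · rcases hG' with ⟨-, hG'⟩ | ⟨-, hG'⟩
      · rw [hF', hG', hFG]
      · exact eq_of_pair_not_trace hcard hG hF hG2 hPG (hFG ▸ hPF) hG'
    · exact (eq_of_pair_not_trace hcard hF hG hF2 hPF (hFG ▸ hPG) hF').symm

/-- In a large family, two distinct members cannot miss the same singleton trace. -/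
theorem eq_of_singleton_not_trace {n : ℕ} (hn : 6 ≤ n) {V : Finset ℕ} (hV : V.card = n)
    {𝒻 : Finset (Finset ℕ)}
    (hsub : ∀ F ∈ 𝒻, F ⊆ V) (hcard : ∀ F ∈ 𝒻, F.card = 3)
    (hVC : ∀ S ⊆ V, S.card = 3 → ¬ Shatters 𝒻 S)
    (hbig : (n - 1).choose 2 + 2 ≤ 𝒻.card)
    (ih : ∀ (V : Finset ℕ) (𝒢 : Finset (Finset ℕ)), V.card = n - 1 →
      (∀ G ∈ 𝒢, G ⊆ V) → (∀ G ∈ 𝒢, G.card = 3) →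
      (∀ S ⊆ V, S.card = 3 → ¬ Shatters 𝒢 S) →
      𝒢.card ≤ (n - 2).choose 2 + 1)
    {x : ℕ} {F F' : Finset ℕ} (hF : F ∈ 𝒻) (hF' : F' ∈ 𝒻) (hxF : x ∈ F) (hxF' : x ∈ F')
    (h : ∀ G ∈ 𝒻, G ∩ F ≠ {x}) (h' : ∀ G ∈ 𝒻, G ∩ F' ≠ {x}) : F = F' := by
  by_contra hne
  obtain ⟨a, ha, hax⟩ : ∃ a ∈ F' ∩ F, a ≠ x := by
    by_contra! hcon
    exact h F' hF' (eq_singleton_iff_unique_mem.2 ⟨mem_inter.2 ⟨hxF', hxF⟩, hcon⟩)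
  obtain ⟨haF', haF⟩ := mem_inter.1 ha
  obtain ⟨b, hbx, hba, rfl⟩ := exists_eq_triple (hcard F hF) hxF haF hax
  obtain ⟨c, hcx, hca, rfl⟩ := exists_eq_triple (hcard F' hF') hxF' haF' hax
  have hbc : b ≠ c := fun hbc => hne (by rw [hbc])
  have hxV : x ∈ V := hsub _ hF hxF
  have haV : a ∈ V := hsub _ hF haF
  have hlink : 𝒻.filter (fun G => x ∈ G) ⊆
      insert {x, b, c} (((V.erase x).erase a).image (fun y => ({x, a, y} : Finset ℕ))) := by
    intro G hG
    obtain ⟨hG, hxG⟩ := mem_filter.1 hG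
    by_cases haG : a ∈ G
    · obtain ⟨y, hyx, hya, rfl⟩ := exists_eq_triple (hcard G hG) hxG haG hax
      refine mem_insert_of_mem (mem_image.2 ⟨y, ?_, rfl⟩)
      simp only [mem_erase]
      exact ⟨hya, hyx, hsub _ hG (by simp)⟩
    · have hbG : b ∈ G := by
        by_contra hbG
        exact h G hG (by grind)
      have hcG : c ∈ G := by
        by_contra hcG
        exact h' G hG (by grind)
      refine mem_insert.2 (Or.inl (eq_of_subset_of_card_le
        (by simp [insert_subset_iff, hxG, hbG, hcG]) ?_).symm)
      rw [hcard G hG, card_eq_three.2 ⟨x, b, c, hbx.symm, hcx.symm, hbc, rfl⟩]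
  have hVcard : ((V.erase x).erase a).card = n - 2 := by
    rw [card_erase_of_mem (mem_erase.2 ⟨hax, haV⟩), card_erase_of_mem hxV, hV]
    rfl
  have hlinkle : (insert {x, b, c} (((V.erase x).erase a).image
      (fun y => ({x, a, y} : Finset ℕ)))).card ≤ n - 1 := by
    refine (card_insert_le _ _).trans ?_
    have := card_image_le (s := (V.erase x).erase a) (f := fun y => ({x, a, y} : Finset ℕ))
    omega
  have hdel : (𝒻.filter (fun G => x ∉ G)).card ≤ (n - 2).choose 2 + 1 := by
    refine ih (V.erase x) _ (by rw [card_erase_of_mem hxV, hV]) ?_ ?_ ?_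
    · intro G hG
      obtain ⟨hG, hxG⟩ := mem_filter.1 hG
      exact subset_erase.2 ⟨hsub G hG, hxG⟩
    · exact fun G hG => hcard G (mem_filter.1 hG).1
    · intro S hS hS3 hsh
      refine hVC S (hS.trans (erase_subset _ _)) hS3 fun T hT => ?_
      obtain ⟨G, hG, hGS⟩ := hsh T hT
      exact ⟨G, (mem_filter.1 hG).1, hGS⟩
  have hsplit := card_filter_add_card_filter_not (s := 𝒻) (fun G => x ∈ G)
  have hpascal : (n - 1).choose 2 = (n - 2) + (n - 2).choose 2 := by
    obtain ⟨m, rfl⟩ : ∃ m, n = m + 2 := ⟨n - 2, by omega⟩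
    simp [Nat.choose_succ_succ' m 1]
  have heq := eq_of_subset_of_card_le hlink (by omega)
  have hstar : ∀ y ∈ (V.erase x).erase a, ({x, a, y} : Finset ℕ) ∈ 𝒻 := by
    intro y hy
    have hmem := mem_insert_of_mem (b := ({x, b, c} : Finset ℕ))
      (mem_image_of_mem (fun y => ({x, a, y} : Finset ℕ)) hy)
    rw [← heq] at hmem
    exact (mem_filter.1 hmem).1
  have hlt := card_filter_notMem_le (by omega) hsub hcard hVC hxV haV hax hstar
  rw [hV] at hlt
  have := card_le_card hlink
  omega

/-- Under the inductive hypothesis and `|𝒻| ≥ C(n-1,2) + 2`, we have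
`|𝒻| = |ℬ| + |L| + |𝒞|` where `ℬ` is the set of 2-element witnesses, `L` the set of
elements serving as singleton witnesses, and `𝒞` the members with empty witness. -/
theorem stmt_11 (n : ℕ) (hn : 8 ≤ n) (𝒻 : Finset (Finset ℕ))
    (hsub : ∀ F ∈ 𝒻, F ⊆ Finset.Icc 1 n) (hcard : ∀ F ∈ 𝒻, F.card = 3)
    (hVC : ∀ S ⊆ Finset.Icc 1 n, S.card = 3 → ¬ Shatters 𝒻 S)
    (hbig : (n - 1).choose 2 + 2 ≤ 𝒻.card)
    (ih : ∀ (V : Finset ℕ) (𝒢 : Finset (Finset ℕ)), V.card = n - 1 →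
      (∀ G ∈ 𝒢, G ⊆ V) → (∀ G ∈ 𝒢, G.card = 3) →
      (∀ S ⊆ V, S.card = 3 → ¬ Shatters 𝒢 S) →
      𝒢.card ≤ (n - 2).choose 2 + 1)
    (W : Finset ℕ → Finset ℕ) (hW : MaximalWitness 𝒻 W) :
    𝒻.card =
      ((𝒻.filter (fun F => (W F).card = 2)).image W).card +
      ((Finset.Icc 1 n).filter (fun x => ∃ F ∈ 𝒻, W F = {x})).card +
      (𝒻.filter (fun F => W F = ∅)).card := by
  have hsing : ∀ F ∈ 𝒻, ∀ x, W F = {x} → x ∈ F := fun F hF x hx =>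
    (hW F hF).1.subset (by simp [hx])
  have hpairs : ((𝒻.filter (fun F => (W F).card = 2)).image W).card =
      (𝒻.filter (fun F => (W F).card = 2)).card := by
    refine card_image_of_injOn fun F hF G hG hFG => ?_
    obtain ⟨hF, -⟩ := mem_filter.1 hF
    obtain ⟨hG, hG2⟩ := mem_filter.1 hG
    exact eq_of_pair_not_trace hcard hG hF hG2 (hW G hG).1.subset
      (hFG ▸ (hW F hF).1.subset) (hW G hG).2.1
  have hsingles : ((Finset.Icc 1 n).filter (fun x => ∃ F ∈ 𝒻, W F = {x})).card =
      (𝒻.filter (fun F => (W F).card = 1)).card := by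
    rw [← card_image_of_injective _ (singleton_injective (α := ℕ)),
      ← card_image_of_injOn (s := 𝒻.filter (fun F => (W F).card = 1)) (f := W)]
    · congr 1
      ext B
      simp only [mem_image, mem_filter, card_eq_one]
      constructor
      · rintro ⟨x, ⟨-, F, hF, hx⟩, rfl⟩
        exact ⟨F, ⟨hF, x, hx⟩, hx⟩
      · rintro ⟨F, ⟨hF, x, hx⟩, rfl⟩
        exact ⟨x, ⟨hsub F hF (hsing F hF x hx), F, hF, hx⟩, hx.symm⟩
    · intro F hF G hG hFG
      obtain ⟨hF, hF1⟩ := mem_filter.1 hF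
      obtain ⟨hG, -⟩ := mem_filter.1 hG
      obtain ⟨x, hx⟩ := card_eq_one.1 hF1
      have hx' : W G = {x} := hFG ▸ hx
      exact eq_of_singleton_not_trace (by omega) (by simp) hsub hcard hVC hbig ih hF hG
        (hsing F hF x hx) (hsing G hG x hx') (hx ▸ (hW F hF).2.1) (hx' ▸ (hW G hG).2.1)
  have hW3 : ∀ F ∈ 𝒻, (W F).card ∈ range 3 := fun F hF => by
    rw [mem_range, ← hcard F hF]
    exact card_lt_card (hW F hF).1
  rw [hpairs, hsingles, card_eq_sum_card_fiberwise hW3]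
  simp only [sum_range_succ, sum_range_zero, card_eq_zero]
  omega
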